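/- arXiv:1606.04999 — 2 statements merged into one kernel-verified Lean document; each statement's English description precedes it below -/
import Mathlib

section
/- Let U : C → D be a pullback-preserving functor between categories with pullbacks, and consider descent with respect to the basic fibrations of C and D. (1) If U is faithful, then U reflects almost descent morphisms: for every morphism p of C, if U(p) is of almost descent in D then p is of almost descent in C. (2) If U is fully faithful, then U reflects descent morphisms: if U(p) is of descent in D then p is of descent in C. -/
/-!
STATEMENT 0: Let `U : C → D` be a pullback-preserving functor between categories with
pullbacks.  (1) If `U` is faithful, then `U` reflects almost descent morphisms.
(2) If `U` is fully faithful, then `U` reflects descent morphisms.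

Here, for the basic fibration of a category with pullbacks, a morphism `p : E ⟶ B` is of
almost descent / descent / effective descent according as the comparison functor from
`Over B` into the category of descent data for `p` is faithful / fully faithful / an
equivalence.  We use the standard (Bénabou–Roubaud) presentation of the category of
descent data for the basic fibration as the Eilenberg–Moore category of the monad induced
by the adjunction `Over.map p ⊣ Over.pullback p`, the comparison functor being the
Eilenberg–Moore comparison functor.
-/

open CategoryTheory Limits

namespace Stmt0

variable {C : Type*} [Category C]

/-- The comparison functor from `Over B` to the category of descent data of `p`
(presented as the Eilenberg–Moore category of the monad of `Over.map p ⊣ Over.pullback p`). -/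
noncomputable def descentComparison [HasPullbacks C] {E B : C} (p : E ⟶ B) :
    Over B ⥤ (Over.mapPullbackAdj p).toMonad.Algebra :=
  Monad.comparison (Over.mapPullbackAdj p)

/-- `p` is of almost descent (w.r.t. the basic fibration) if the comparison functor into
the category of descent data is faithful. -/
def IsAlmostDescentMorphism [HasPullbacks C] {E B : C} (p : E ⟶ B) : Prop :=
  (descentComparison p).Faithful

/-- `p` is of descent (w.r.t. the basic fibration) if the comparison functor into
the category of descent data is fully faithful. -/
def IsDescentMorphism [HasPullbacks C] {E B : C} (p : E ⟶ B) : Prop :=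
  (descentComparison p).Faithful ∧ (descentComparison p).Full

/-- `p` is of effective descent (w.r.t. the basic fibration) if the comparison functor into
the category of descent data is an equivalence. -/
def IsEffectiveDescentMorphism [HasPullbacks C] {E B : C} (p : E ⟶ B) : Prop :=
  (descentComparison p).IsEquivalence

end Stmt0

namespace Stmt0

universe v₁ v₂ u₁ u₂

section Abstract

variable {A : Type u₁} {X : Type u₂} [Category.{v₁} A] [Category.{v₂} X]
    {L : A ⥤ X} {R : X ⥤ A}

theorem abs1
    (ε : ∀ P, L.obj (R.obj P) ⟶ P)
    (η : ∀ a, a ⟶ R.obj (L.obj a))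
    (hε : ∀ {P Q : X} (k : P ⟶ Q), L.map (R.map k) ≫ ε Q = ε P ≫ k)
    (hη : ∀ {a b : A} (k : a ⟶ b), k ≫ η b = η a ≫ R.map (L.map k))
    (t1 : ∀ a, L.map (η a) ≫ ε (L.obj a) = 𝟙 _)
    (t2 : ∀ P, η (R.obj P) ≫ R.map (ε P) = 𝟙 _)
    (P Q : X) (h : L.obj (R.obj P) ⟶ Q)
    (hh : L.map (R.map (ε P)) ≫ h = ε (L.obj (R.obj P)) ≫ h) :
    R.map (L.map (η (R.obj P) ≫ R.map h)) ≫ R.map (ε Q) =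
            R.map (ε P) ≫ η (R.obj P) ≫ R.map h := by
  have e1 : R.map (ε P) ≫ η (R.obj P) ≫ R.map h = R.map h := by
    rw [← Category.assoc, hη, Category.assoc, ← R.map_comp, hh, R.map_comp, ← Category.assoc,
      t2, Category.id_comp]
  rw [e1, ← R.map_comp, L.map_comp, Category.assoc, hε, ← Category.assoc, t1, Category.id_comp]

theorem abs2
    (ε : ∀ P, L.obj (R.obj P) ⟶ P)
    (η : ∀ a, a ⟶ R.obj (L.obj a))
    (hε : ∀ {P Q : X} (k : P ⟶ Q), L.map (R.map k) ≫ ε Q = ε P ≫ k)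
    (t1 : ∀ a, L.map (η a) ≫ ε (L.obj a) = 𝟙 _)
    (P Q : X) (h : L.obj (R.obj P) ⟶ Q) (k : P ⟶ Q)
    (hk : R.map k = η (R.obj P) ≫ R.map h) : ε P ≫ k = h := by
  rw [← hε, hk, L.map_comp, Category.assoc, hε, ← Category.assoc, t1, Category.id_comp]

theorem abs3
    (ε : ∀ P, L.obj (R.obj P) ⟶ P)
    (hε : ∀ {P Q : X} (k : P ⟶ Q), L.map (R.map k) ≫ ε Q = ε P ≫ k)
    (P Q : X) (f : R.obj P ⟶ R.obj Q)
    (hf : R.map (L.map f) ≫ R.map (ε Q) = R.map (ε P) ≫ f) :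
    L.map (R.map (ε P)) ≫ L.map f ≫ ε Q = ε (L.obj (R.obj P)) ≫ L.map f ≫ ε Q := by
  rw [← Category.assoc, ← L.map_comp, ← hf, L.map_comp, Category.assoc, hε, ← Category.assoc,
    hε, Category.assoc]

theorem abs4
    (ε : ∀ P, L.obj (R.obj P) ⟶ P)
    (η : ∀ a, a ⟶ R.obj (L.obj a))
    (hη : ∀ {a b : A} (k : a ⟶ b), k ≫ η b = η a ≫ R.map (L.map k))
    (t2 : ∀ P, η (R.obj P) ≫ R.map (ε P) = 𝟙 _)
    (P Q : X) (f : R.obj P ⟶ R.obj Q) (k : P ⟶ Q)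
    (hk : ε P ≫ k = L.map f ≫ ε Q) : R.map k = f := by
  have e := congrArg (fun t => η (R.obj P) ≫ R.map t) hk
  simp only [R.map_comp] at e
  rw [← Category.assoc, t2, Category.id_comp, ← Category.assoc, ← hη, Category.assoc, t2,
    Category.comp_id] at e
  exact e

end Abstract

theorem comparison_full_iff {A : Type u₁} {X : Type u₂} [Category.{v₁} A] [Category.{v₂} X]
    {L : A ⥤ X} {R : X ⥤ A} (adj : L ⊣ R) :
    (Monad.comparison adj).Full ↔ ∀ (P Q : X) (h : L.obj (R.obj P) ⟶ Q),
      L.map (R.map (adj.counit.app P)) ≫ h = adj.counit.app (L.obj (R.obj P)) ≫ h →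
        ∃ k : P ⟶ Q, adj.counit.app P ≫ k = h := by
  have hε : ∀ {P Q : X} (k : P ⟶ Q),
      L.map (R.map k) ≫ adj.counit.app Q = adj.counit.app P ≫ k :=
    fun k => adj.counit.naturality k
  have hη : ∀ {a b : A} (k : a ⟶ b), k ≫ adj.unit.app b = adj.unit.app a ≫ R.map (L.map k) :=
    fun k => adj.unit.naturality k
  have t1 : ∀ a, L.map (adj.unit.app a) ≫ adj.counit.app (L.obj a) = 𝟙 _ :=
    fun a => adj.left_triangle_components a
  have t2 : ∀ P, adj.unit.app (R.obj P) ≫ R.map (adj.counit.app P) = 𝟙 _ :=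
    fun a => adj.right_triangle_components a
  constructor
  · intro hF P Q h hh
    let f : (Monad.comparison adj).obj P ⟶ (Monad.comparison adj).obj Q :=
      { f := adj.unit.app (R.obj P) ≫ R.map h
        h := abs1 (fun P => adj.counit.app P) (fun a => adj.unit.app a) hε hη t1 t2 P Q h hh }
    obtain ⟨k, hk⟩ := hF.map_surjective f
    exact ⟨k, abs2 (fun P => adj.counit.app P) (fun a => adj.unit.app a) hε t1 P Q h k
      (congrArg Monad.Algebra.Hom.f hk)⟩
  · intro H
    refine ⟨fun {P Q} f => ?_⟩
    obtain ⟨k, hk⟩ := H P Q (L.map (X := R.obj P) (Y := R.obj Q) f.f ≫ adj.counit.app Q)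
      (abs3 (fun P => adj.counit.app P) hε P Q f.f f.h)
    exact ⟨k, Monad.Algebra.Hom.ext
      (abs4 (fun P => adj.counit.app P) (fun a => adj.unit.app a) hη t2 P Q f.f k hk)⟩

theorem map_fst {C : Type u₁} [Category.{v₁} C] [HasPullbacks C] {E B : C} (p : E ⟶ B)
    {X Y : Over B} (f : X ⟶ Y) :
    ((Over.pullback p).map f).left ≫ pullback.fst Y.hom p = pullback.fst X.hom p ≫ f.left :=
  pullback.lift_fst _ _ _

theorem map_snd {C : Type u₁} [Category.{v₁} C] [HasPullbacks C] {E B : C} (p : E ⟶ B)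
    {X Y : Over B} (f : X ⟶ Y) :
    ((Over.pullback p).map f).left ≫ pullback.snd Y.hom p = pullback.snd X.hom p :=
  pullback.lift_snd _ _ _

theorem counit_left {C : Type u₁} [Category.{v₁} C] [HasPullbacks C] {E B : C} (p : E ⟶ B)
    (X : Over B) :
    ((Over.mapPullbackAdj p).counit.app X).left = pullback.fst X.hom p := by
  simp

/-- The map `LRε` on underlying objects. -/
noncomputable def mm {C : Type u₁} [Category.{v₁} C] [HasPullbacks C] {E B X : C} (p : E ⟶ B)
    (x : X ⟶ B) : pullback (pullback.snd x p ≫ p) p ⟶ pullback x p :=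
  pullback.lift (pullback.fst _ _ ≫ pullback.fst _ _) (pullback.snd _ _) (by
    rw [Category.assoc, pullback.condition, pullback.condition])

theorem mm_fst {C : Type u₁} [Category.{v₁} C] [HasPullbacks C] {E B X : C} (p : E ⟶ B)
    (x : X ⟶ B) : mm p x ≫ pullback.fst x p =
      pullback.fst (pullback.snd x p ≫ p) p ≫ pullback.fst x p :=
  pullback.lift_fst _ _ _

theorem mm_snd {C : Type u₁} [Category.{v₁} C] [HasPullbacks C] {E B X : C} (p : E ⟶ B)
    (x : X ⟶ B) : mm p x ≫ pullback.snd x p = pullback.snd (pullback.snd x p ≫ p) p :=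
  pullback.lift_snd _ _ _

theorem LRcounit_left {C : Type u₁} [Category.{v₁} C] [HasPullbacks C] {E B : C} (p : E ⟶ B)
    (X : Over B) :
    ((Over.map p).map ((Over.pullback p).map ((Over.mapPullbackAdj p).counit.app X))).left =
      mm p X.hom := by
  apply pullback.hom_ext
  · refine (map_fst p ((Over.mapPullbackAdj p).counit.app X)).trans ?_
    refine Eq.trans ?_ (pullback.lift_fst _ _ _).symm
    rw [counit_left]
    rfl
  · refine (map_snd p ((Over.mapPullbackAdj p).counit.app X)).trans ?_
    exact (pullback.lift_snd _ _ _).symm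

theorem fork_iff {C : Type u₁} [Category.{v₁} C] [HasPullbacks C] {E B : C} (p : E ⟶ B)
    (X Y : Over B) (h : (Over.map p).obj ((Over.pullback p).obj X) ⟶ Y) :
    (Over.map p).map ((Over.pullback p).map ((Over.mapPullbackAdj p).counit.app X)) ≫ h =
      (Over.mapPullbackAdj p).counit.app ((Over.map p).obj ((Over.pullback p).obj X)) ≫ h ↔
    mm p X.hom ≫ h.left = pullback.fst (pullback.snd X.hom p ≫ p) p ≫ h.left := by
  have e1 := LRcounit_left p X
  have e2 := counit_left p ((Over.map p).obj ((Over.pullback p).obj X))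
  constructor
  · intro hh
    have hh' := congrArg CommaMorphism.left hh
    refine Eq.trans ?_ (hh'.trans ?_)
    · exact (congrArg (fun t => t ≫ h.left) e1).symm
    · exact (congrArg (fun t => t ≫ h.left) e2)
  · intro hh
    apply Over.OverMorphism.ext
    refine Eq.trans ?_ (hh.trans ?_)
    · exact (congrArg (fun t => t ≫ h.left) e1)
    · exact (congrArg (fun t => t ≫ h.left) e2).symm

theorem fork_iff' {C : Type u₁} [Category.{v₁} C] [HasPullbacks C] {E B X Y : C} (p : E ⟶ B)
    (x : X ⟶ B) (h : pullback x p ⟶ Y) :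
    mm p x ≫ h = pullback.fst (pullback.snd x p ≫ p) p ≫ h ↔
    (∀ (T : C) (a b : T ⟶ pullback x p), a ≫ pullback.fst x p = b ≫ pullback.fst x p →
        a ≫ h = b ≫ h) := by
  constructor
  · intro hh T a b hab
    have hc : a ≫ pullback.snd x p ≫ p = (b ≫ pullback.snd x p) ≫ p := by
      simp only [Category.assoc, ← pullback.condition, reassoc_of% hab]
    have e := congrArg (fun t => pullback.lift a (b ≫ pullback.snd x p) hc ≫ t) hh
    have e3 : pullback.lift a (b ≫ pullback.snd x p) hc ≫ mm p x = b := by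
      apply pullback.hom_ext
      · rw [Category.assoc, mm_fst, ← Category.assoc, pullback.lift_fst, hab]
      · rw [Category.assoc, mm_snd, pullback.lift_snd]
    simp only [← Category.assoc] at e
    rw [e3, pullback.lift_fst] at e
    exact e.symm
  · intro hT
    exact hT _ _ _ (mm_fst p x)

theorem almost_iff {C : Type u₁} [Category.{v₁} C] [HasPullbacks C] {E B : C} (p : E ⟶ B) :
    IsAlmostDescentMorphism p ↔ ∀ (X Y : C) (x : X ⟶ B) (y : Y ⟶ B) (f g : X ⟶ Y),
      f ≫ y = x → g ≫ y = x → pullback.fst x p ≫ f = pullback.fst x p ≫ g → f = g := by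
  constructor
  · intro hF X Y x y f g hf hg hfg
    let F : Over.mk x ⟶ Over.mk y := Over.homMk f hf
    let G : Over.mk x ⟶ Over.mk y := Over.homMk g hg
    have : F = G := by
      apply hF.map_injective
      apply Monad.Algebra.Hom.ext
      change (Over.pullback p).map F = (Over.pullback p).map G
      apply Over.OverMorphism.ext
      apply pullback.hom_ext
      · exact (map_fst p F).trans (hfg.trans (map_fst p G).symm)
      · exact (map_snd p F).trans (map_snd p G).symm
    exact congrArg CommaMorphism.left this
  · intro H
    refine ⟨fun {X Y} f g hfg => ?_⟩
    ext
    refine H _ _ X.hom Y.hom f.left g.left (Over.w f) (Over.w g) ?_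
    have h1 : (Over.pullback p).map f = (Over.pullback p).map g :=
      congrArg Monad.Algebra.Hom.f hfg
    rw [← map_fst, ← map_fst, h1]

theorem full_iff {C : Type u₁} [Category.{v₁} C] [HasPullbacks C] {E B : C} (p : E ⟶ B) :
    (descentComparison p).Full ↔ ∀ (X Y : C) (x : X ⟶ B) (y : Y ⟶ B) (h : pullback x p ⟶ Y),
      h ≫ y = pullback.fst x p ≫ x →
      (∀ (T : C) (a b : T ⟶ pullback x p), a ≫ pullback.fst x p = b ≫ pullback.fst x p →
        a ≫ h = b ≫ h) →
      ∃ k : X ⟶ Y, k ≫ y = x ∧ pullback.fst x p ≫ k = h := by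
  unfold descentComparison
  rw [comparison_full_iff]
  constructor
  · intro H X Y x y h hy hT
    obtain ⟨k, hk⟩ := H (Over.mk x) (Over.mk y)
      (Over.homMk h (hy.trans pullback.condition))
      ((fork_iff p _ _ _).2 ((fork_iff' p x h).2 hT))
    refine ⟨k.left, Over.w k, ?_⟩
    refine Eq.trans ?_ (congrArg CommaMorphism.left hk)
    exact (congrArg (fun t => t ≫ k.left) (counit_left p (Over.mk x))).symm
  · intro H X Y h hh
    obtain ⟨k, hk1, hk2⟩ := H X.left Y.left X.hom Y.hom h.left
      ((Over.w h).trans pullback.condition.symm)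
      ((fork_iff' p X.hom h.left).1 ((fork_iff p X Y h).1 hh))
    refine ⟨Over.homMk k hk1, Over.OverMorphism.ext (Eq.trans ?_ hk2)⟩
    exact (congrArg (fun t => t ≫ k) (counit_left p X))

end Stmt0

open Stmt0 in
theorem statement0 {C D : Type*} [Category C] [Category D]
    [HasPullbacks C] [HasPullbacks D] (U : C ⥤ D)
    [PreservesLimitsOfShape WalkingCospan U] :
    (U.Faithful → ∀ {E B : C} (p : E ⟶ B),
        IsAlmostDescentMorphism (U.map p) → IsAlmostDescentMorphism p) ∧
    (U.Full → U.Faithful → ∀ {E B : C} (p : E ⟶ B),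
        IsDescentMorphism (U.map p) → IsDescentMorphism p) := by
  constructor
  · intro hU E B p
    rw [almost_iff, almost_iff]
    intro H X Y x y f g hf hg hfg
    apply U.map_injective
    refine H _ _ (U.map x) (U.map y) _ _ (by rw [← U.map_comp, hf]) (by rw [← U.map_comp, hg]) ?_
    have hP := (IsPullback.of_hasPullback x p).map U
    rw [← cancel_epi hP.isoPullback.hom]
    simp only [IsPullback.isoPullback_hom_fst_assoc, ← U.map_comp, hfg]
  · intro hU1 hU2 E B p hp
    refine ⟨(almost_iff p).2 ?_, ?_⟩
    · have H := (almost_iff _).1 hp.1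
      intro X Y x y f g hf hg hfg
      apply U.map_injective
      refine H _ _ (U.map x) (U.map y) _ _ (by rw [← U.map_comp, hf])
        (by rw [← U.map_comp, hg]) ?_
      have hP := (IsPullback.of_hasPullback x p).map U
      rw [← cancel_epi hP.isoPullback.hom]
      simp only [IsPullback.isoPullback_hom_fst_assoc, ← U.map_comp, hfg]
    · have H := (full_iff _).1 hp.2
      rw [full_iff]
      intro X Y x y h hy hT
      have hP := (IsPullback.of_hasPullback x p).map U
      have hK := (IsPullback.of_hasPullback (pullback.fst x p) (pullback.fst x p)).map U
      obtain ⟨k, hk1, hk2⟩ := H _ _ (U.map x) (U.map y) (hP.isoPullback.inv ≫ U.map h)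
        (by
          rw [Category.assoc, ← U.map_comp, hy, U.map_comp, IsPullback.isoPullback_inv_fst_assoc])
        (by
          intro T a b hab
          have hc : (a ≫ hP.isoPullback.inv) ≫ U.map (pullback.fst x p) =
              (b ≫ hP.isoPullback.inv) ≫ U.map (pullback.fst x p) := by
            simpa using hab
          rw [← Category.assoc, ← Category.assoc, ← hK.lift_fst _ _ hc]
          conv_rhs => rw [← hK.lift_snd _ _ hc]
          simp only [Category.assoc, ← U.map_comp]
          rw [hT _ _ _ pullback.condition])
      refine ⟨U.preimage k, ?_, ?_⟩
      · apply U.map_injective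
        simpa using hk1
      · apply U.map_injective
        rw [Iso.eq_inv_comp, IsPullback.isoPullback_hom_fst_assoc] at hk2
        simpa using hk2
end

section
/- Let C and D be categories with pullbacks and U : C → D a fully faithful pullback-preserving functor. Let p : E → B be a morphism of C such that U(p) is of effective descent in D. Then p is of effective descent in C if and only if it satisfies the following property: whenever a commutative square in D with vertex U(P), sides U(P) → A, U(P) → U(E), A → U(B) and U(E) → U(B) = U(p) is a pullback square, there exists an object C' of C with U(C') ≅ A. -/
/-!
STATEMENT 1: Let `C`, `D` be categories with pullbacks and `U : C ⥤ D` a fully faithful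
pullback-preserving functor.  Let `p : E ⟶ B` be a morphism of `C` such that `U(p)` is of
effective descent in `D`.  Then `p` is of effective descent in `C` if and only if:
whenever a commutative square in `D` with vertex `U(P)`, sides `U(P) ⟶ A`,
`U(P) ⟶ U(E)`, `A ⟶ U(B)` and `U(p) : U(E) ⟶ U(B)` is a pullback square, there is an
object `C'` of `C` with `U(C') ≅ A`.

Effective descent (w.r.t. the basic fibration) is encoded via the Eilenberg–Moore
comparison functor of the adjunction `Over.map p ⊣ Over.pullback p`, whose codomain is the
standard presentation of the category of descent data of `p`.
-/

open CategoryTheory Limits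

namespace Stmt1

variable {C : Type*} [Category C]

/-- The comparison functor from `Over B` to the category of descent data of `p`. -/
noncomputable def descentComparison [HasPullbacks C] {E B : C} (p : E ⟶ B) :
    Over B ⥤ (Over.mapPullbackAdj p).toMonad.Algebra :=
  Monad.comparison (Over.mapPullbackAdj p)

/-- `p` is of effective descent if the comparison functor into the category of descent
data is an equivalence. -/
def IsEffectiveDescentMorphism [HasPullbacks C] {E B : C} (p : E ⟶ B) : Prop :=
  (descentComparison p).IsEquivalence

end Stmt1

namespace Stmt1

section Abstract

variable {C₁ C₂ : Type*} [Category C₁] [Category C₂] {T : Monad C₁} {T' : Monad C₂}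

/-- A functor together with an invertible compatibility between two monads. -/
structure MonadSquare (T : Monad C₁) (T' : Monad C₂) (F : C₁ ⥤ C₂) where
  θ : ∀ X : C₁, T'.toFunctor.obj (F.obj X) ≅ F.obj (T.toFunctor.obj X)
  nat : ∀ {X Y : C₁} (f : X ⟶ Y),
    T'.toFunctor.map (F.map f) ≫ (θ Y).hom = (θ X).hom ≫ F.map (T.toFunctor.map f)
  unit : ∀ X : C₁, T'.η.app (F.obj X) ≫ (θ X).hom = F.map (T.η.app X)
  mul : ∀ X : C₁, T'.μ.app (F.obj X) ≫ (θ X).hom =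
    T'.toFunctor.map (θ X).hom ≫ (θ (T.toFunctor.obj X)).hom ≫ F.map (T.μ.app X)

variable {F : C₁ ⥤ C₂} (S : MonadSquare T T' F)

def MonadSquare.lift : T.Algebra ⥤ T'.Algebra where
  obj X :=
    { A := F.obj X.A
      a := (S.θ X.A).hom ≫ F.map X.a
      unit := by
        have h := S.unit X.A
        rw [← Category.assoc, h, ← F.map_comp, X.unit]
        exact F.map_id _
      assoc := by
        rw [← Category.assoc, S.mul, Functor.map_comp, Category.assoc, Category.assoc,
          ← F.map_comp, X.assoc, F.map_comp, Category.assoc, reassoc_of% (S.nat X.a)] }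
  map {X Y} f :=
    { f := F.map f.f
      h := by
        change T'.toFunctor.map (F.map f.f) ≫ (S.θ Y.A).hom ≫ F.map Y.a =
          ((S.θ X.A).hom ≫ F.map X.a) ≫ F.map f.f
        rw [reassoc_of% (S.nat f.f), Category.assoc, ← F.map_comp, ← F.map_comp, f.h] }
  map_id X := by ext; exact F.map_id _
  map_comp f g := by ext; exact F.map_comp _ _

lemma MonadSquare.lift_faithful [F.Faithful] : S.lift.Faithful where
  map_injective {X Y} f g h := by
    ext
    exact F.map_injective (congrArg Monad.Algebra.Hom.f h)

lemma MonadSquare.lift_full [F.Faithful] [F.Full] : S.lift.Full where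
  map_surjective {X Y} f := by
    obtain ⟨g, hg⟩ := F.map_surjective (X := X.A) (Y := Y.A) f.f
    refine ⟨⟨g, ?_⟩, ?_⟩
    · apply F.map_injective
      rw [← cancel_epi (S.θ X.A).hom, F.map_comp, F.map_comp, ← reassoc_of% (S.nat g), hg]
      have := f.h
      simp only [MonadSquare.lift, Category.assoc] at this
      exact this
    · ext
      exact hg

lemma MonadSquare.exists_lift [F.Faithful] [F.Full] (Z : T'.Algebra) (X : C₁)
    (e : F.obj X ≅ Z.A) : ∃ Y : T.Algebra, Nonempty (S.lift.obj Y ≅ Z) := by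
  obtain ⟨a, ha⟩ := F.map_surjective
    ((S.θ X).inv ≫ T'.toFunctor.map e.hom ≫ Z.a ≫ e.inv)
  have ha' : (S.θ X).hom ≫ F.map a = T'.toFunctor.map e.hom ≫ Z.a ≫ e.inv := by
    rw [ha, Iso.hom_inv_id_assoc]
  refine ⟨⟨X, a, ?_, ?_⟩, ⟨Monad.Algebra.isoMk e ?_⟩⟩
  · apply F.map_injective
    rw [F.map_comp, ← S.unit, Category.assoc, ha']
    have := T'.η.naturality_assoc e.hom (Z.a ≫ e.inv)
    refine this.symm.trans ?_
    rw [Z.unit_assoc]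
    exact e.hom_inv_id.trans (F.map_id X).symm
  · apply F.map_injective
    rw [← cancel_epi (S.θ (T.toFunctor.obj X)).hom,
      ← cancel_epi (T'.toFunctor.map (S.θ X).hom), F.map_comp, F.map_comp,
      ← reassoc_of% (S.nat a), ha', ← Functor.map_comp_assoc, ha']
    have h1 := S.mul X
    have h2 := congrArg (· ≫ F.map a) h1
    simp only [Category.assoc] at h2
    rw [← h2, ha']
    have := T'.μ.naturality_assoc e.hom (Z.a ≫ e.inv)
    rw [← this, Z.assoc_assoc]
    simp
  · simp only [MonadSquare.lift]
    rw [ha']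
    simp

lemma MonadSquare.main [F.Faithful] [F.Full] {X₁ X₂ : Type*} [Category X₁] [Category X₂]
    (K : X₁ ⥤ T.Algebra) (K' : X₂ ⥤ T'.Algebra) (V : X₁ ⥤ X₂) [V.Full] [V.Faithful]
    (i : K ⋙ S.lift ≅ V ⋙ K') (hK' : K'.IsEquivalence) :
    K.IsEquivalence ↔ ∀ (A : X₂) (X : C₁), Nonempty (F.obj X ≅ (K'.obj A).A) →
      ∃ Y : X₁, Nonempty (V.obj Y ≅ A) := by
  have := S.lift_faithful
  have := S.lift_full
  constructor
  · intro hK A X ⟨e⟩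
    obtain ⟨Z, ⟨z⟩⟩ := S.exists_lift (K'.obj A) X e
    refine ⟨K.objPreimage Z, ⟨K'.preimageIso ?_⟩⟩
    exact (i.app _).symm ≪≫ S.lift.mapIso (K.objObjPreimageIso Z) ≪≫ z
  · intro H
    have h1 : (K ⋙ S.lift).Full := Functor.Full.of_iso i.symm
    have h2 : (K ⋙ S.lift).Faithful := Functor.Faithful.of_iso i.symm
    have hf : K.Faithful := Functor.Faithful.of_comp K S.lift
    have hF : K.Full := Functor.Full.of_comp_faithful K S.lift
    refine { essSurj := ⟨fun Z => ?_⟩ }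
    let A := K'.objPreimage (S.lift.obj Z)
    let e : K'.obj A ≅ S.lift.obj Z := K'.objObjPreimageIso _
    obtain ⟨Y, ⟨y⟩⟩ := H A Z.A ⟨(T'.forget.mapIso e).symm⟩
    refine ⟨Y, ⟨S.lift.preimageIso ?_⟩⟩
    exact i.app Y ≪≫ K'.mapIso y ≪≫ e

end Abstract

end Stmt1
namespace Stmt1

section AdjSquare

variable {A B A' B' : Type*} [Category A] [Category B] [Category A'] [Category B']
  {L : A ⥤ B} {R : B ⥤ A} (adj : L ⊣ R) {L' : A' ⥤ B'} {R' : B' ⥤ A'} (adj' : L' ⊣ R')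
  {F : A ⥤ A'} {V : B ⥤ B'} (pc : F ⋙ L' ≅ L ⋙ V)

def ct (Y : B) : L.obj (R.obj Y) ⟶ Y := adj.counit.app Y

/-- The unit with its plain type. -/
def ut (X : A) : X ⟶ R.obj (L.obj X) := adj.unit.app X

/-- The component of the comparison with its plain type. -/
def pcc (X : A) : L'.obj (F.obj X) ⟶ V.obj (L.obj X) := pc.hom.app X

/-- The component of the mate. -/
def mateComp (Y : B) : F.obj (R.obj Y) ⟶ R'.obj (V.obj Y) :=
  adj'.homEquiv _ _ (pcc pc (R.obj Y) ≫ V.map (ct adj Y))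

lemma symm_eq {X : A} {Y : B} (f : X ⟶ R.obj Y) :
    (adj.homEquiv X Y).symm f = L.map f ≫ ct adj Y := adj.homEquiv_counit _ _ _

lemma mate_counit (Y : B) : L'.map (mateComp adj adj' pc Y) ≫ ct adj' (V.obj Y) =
    pcc pc (R.obj Y) ≫ V.map (ct adj Y) := by
  rw [← symm_eq, mateComp, Equiv.symm_apply_apply]

lemma pc_nat {X Y : A} (f : X ⟶ Y) : L'.map (F.map f) ≫ pcc pc Y =
    pcc pc X ≫ V.map (L.map f) := pc.hom.naturality f

lemma counit_nat {X Y : B} (f : X ⟶ Y) : L.map (R.map f) ≫ ct adj Y =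
    ct adj X ≫ f := adj.counit.naturality f

lemma tri (X : A) : L.map (ut adj X) ≫ ct adj (L.obj X) = 𝟙 (L.obj X) :=
  adj.left_triangle_components X

lemma mate_nat {X Y : B} (f : X ⟶ Y) : F.map (R.map f) ≫ mateComp adj adj' pc Y =
    mateComp adj adj' pc X ≫ R'.map (V.map f) := by
  apply (adj'.homEquiv _ _).symm.injective
  rw [symm_eq, symm_eq, L'.map_comp, L'.map_comp,
    Category.assoc, Category.assoc, mate_counit, counit_nat, reassoc_of% (pc_nat pc (R.map f)),
    reassoc_of% (mate_counit adj adj' pc X), ← V.map_comp, ← V.map_comp, counit_nat]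

lemma mate_unit (X : A) : F.map (ut adj X) ≫ mateComp adj adj' pc (L.obj X) =
    ut adj' (F.obj X) ≫ R'.map (pcc pc X) := by
  apply (adj'.homEquiv _ _).symm.injective
  rw [symm_eq, symm_eq, L'.map_comp, L'.map_comp, Category.assoc, Category.assoc,
    mate_counit, counit_nat, reassoc_of% (pc_nat pc (ut adj X)), ← V.map_comp, tri,
    V.map_id, Category.comp_id, reassoc_of% (tri adj' (F.obj X))]

variable [hI : ∀ Y, IsIso (mateComp adj adj' pc Y)]

/-- The mate as an isomorphism. -/
noncomputable def mateIso (Y : B) : F.obj (R.obj Y) ≅ R'.obj (V.obj Y) :=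
  asIso (mateComp adj adj' pc Y)

/-- The induced square of monads. -/
noncomputable def adjSquare : MonadSquare adj.toMonad adj'.toMonad F where
  θ X := R'.mapIso (pc.app X) ≪≫ (asIso (mateComp adj adj' pc (L.obj X))).symm
  nat {X Y} f := by
    change R'.map (L'.map (F.map f)) ≫ R'.map (pcc pc Y) ≫
      inv (mateComp adj adj' pc (L.obj Y)) =
      (R'.map (pcc pc X) ≫ inv (mateComp adj adj' pc (L.obj X))) ≫ F.map (R.map (L.map f))
    rw [← Category.assoc, IsIso.comp_inv_eq, Category.assoc, Category.assoc, mate_nat,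
      IsIso.inv_hom_id_assoc, ← R'.map_comp, pc_nat, R'.map_comp]
  unit X := by
    change ut adj' (F.obj X) ≫ R'.map (pcc pc X) ≫
      inv (mateComp adj adj' pc (L.obj X)) = F.map (ut adj X)
    rw [← Category.assoc, IsIso.comp_inv_eq, mate_unit]
  mul X := by
    change R'.map (ct adj' (L'.obj (F.obj X))) ≫ R'.map (pcc pc X) ≫
      inv (mateComp adj adj' pc (L.obj X)) =
      R'.map (L'.map (R'.map (pcc pc X) ≫ inv (mateComp adj adj' pc (L.obj X)))) ≫
      (R'.map (pcc pc (R.obj (L.obj X))) ≫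
        inv (mateComp adj adj' pc (L.obj (R.obj (L.obj X))))) ≫
        F.map (R.map (ct adj (L.obj X)))
    rw [← Category.assoc, IsIso.comp_inv_eq]
    simp only [Category.assoc]
    rw [mate_nat, IsIso.inv_hom_id_assoc, ← R'.map_comp, ← R'.map_comp, ← R'.map_comp,
      ← mate_counit adj adj', ← L'.map_comp_assoc, Category.assoc, IsIso.inv_hom_id,
      Category.comp_id, counit_nat]

/-- The comparison functors commute with the lift. -/
noncomputable def adjSquareIso : Monad.comparison adj ⋙ (adjSquare adj adj' pc).lift ≅
    V ⋙ Monad.comparison adj' :=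
  NatIso.ofComponents
    (fun Y => Monad.Algebra.isoMk (mateIso adj adj' pc Y) (by
      change R'.map (L'.map (mateComp adj adj' pc Y)) ≫ R'.map (ct adj' (V.obj Y)) =
        ((R'.map (pcc pc (R.obj Y)) ≫ inv (mateComp adj adj' pc (L.obj (R.obj Y)))) ≫
          F.map (R.map (ct adj Y))) ≫ mateComp adj adj' pc Y
      simp only [Category.assoc]
      rw [mate_nat, IsIso.inv_hom_id_assoc, ← R'.map_comp, ← R'.map_comp, mate_counit]))
    (fun f => by
      ext
      exact mate_nat adj adj' pc f)

end AdjSquare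

section Concrete

variable {C D : Type*} [Category C] [Category D]
    [HasPullbacks C] [HasPullbacks D] (U : C ⥤ D)
    {E B : C} (p : E ⟶ B)

/-- Postcomposition commutes with `U`. -/
def postIso : Over.post U ⋙ Over.map (U.map p) ≅ Over.map p ⋙ Over.post U :=
  NatIso.ofComponents
    (fun X => Over.isoMk (Iso.refl (U.obj X.left))
      ((Category.id_comp _).trans (U.map_comp X.hom p)))
    (fun {X Y} f => by
      ext
      exact (Category.comp_id (U.map f.left)).trans (Category.id_comp (U.map f.left)).symm)

lemma counit_left {C : Type*} [Category C] [HasPullbacks C] {E B : C} (p : E ⟶ B)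
    (Y : Over B) : ((Over.mapPullbackAdj p).counit.app Y).left = pullback.fst Y.hom p := by
  simp

lemma mate_fst (Y : Over B) :
    (mateComp (Over.mapPullbackAdj p) (Over.mapPullbackAdj (U.map p)) (postIso U p) Y).left ≫
      pullback.fst (U.map Y.hom) (U.map p) = U.map (pullback.fst Y.hom p) := by
  have h := congrArg CommaMorphism.left
    (mate_counit (Over.mapPullbackAdj p) (Over.mapPullbackAdj (U.map p)) (postIso U p) Y)
  have h1 : ((Over.mapPullbackAdj (U.map p)).counit.app ((Over.post U).obj Y)).left =
    pullback.fst (U.map Y.hom) (U.map p) := counit_left (U.map p) ((Over.post U).obj Y)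
  have h2 := counit_left p Y
  rw [← h1]
  refine h.trans ?_
  refine (Category.id_comp _).trans ?_
  exact congrArg (fun k => U.map k) h2

variable [PreservesLimitsOfShape WalkingCospan U]

lemma isPb (Y : Over B) : IsPullback (U.map (pullback.fst Y.hom p))
    (U.map (pullback.snd Y.hom p)) (U.map Y.hom) (U.map p) :=
  (IsPullback.of_hasPullback Y.hom p).map U

lemma mate_left (Y : Over B) :
    (mateComp (Over.mapPullbackAdj p) (Over.mapPullbackAdj (U.map p)) (postIso U p) Y).left =
      (isPb U p Y).isoPullback.hom := by
  apply pullback.hom_ext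
  · exact (mate_fst U p Y).trans (isPb U p Y).isoPullback_hom_fst.symm
  · exact (Over.w (mateComp (Over.mapPullbackAdj p) (Over.mapPullbackAdj (U.map p))
      (postIso U p) Y)).trans (isPb U p Y).isoPullback_hom_snd.symm

instance mate_iso (Y : Over B) :
    IsIso (mateComp (Over.mapPullbackAdj p) (Over.mapPullbackAdj (U.map p))
      (postIso U p) Y) := by
  have : IsIso ((Over.forget _).map (mateComp (Over.mapPullbackAdj p)
      (Over.mapPullbackAdj (U.map p)) (postIso U p) Y)) := by
    change IsIso (mateComp (Over.mapPullbackAdj p) (Over.mapPullbackAdj (U.map p))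
      (postIso U p) Y).left
    rw [mate_left]
    exact (isPb U p Y).isoPullback.isIso_hom
  exact isIso_of_reflects_iso _ (Over.forget _)

end Concrete

end Stmt1

open Stmt1 in
theorem statement1 {C D : Type*} [Category C] [Category D]
    [HasPullbacks C] [HasPullbacks D] (U : C ⥤ D)
    [PreservesLimitsOfShape WalkingCospan U] (hFull : U.Full) (hFaithful : U.Faithful)
    {E B : C} (p : E ⟶ B) (hUp : IsEffectiveDescentMorphism (U.map p)) :
    IsEffectiveDescentMorphism p ↔
      ∀ (P : C) (A : D) (f : U.obj P ⟶ A) (g : U.obj P ⟶ U.obj E) (h : A ⟶ U.obj B),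
        IsPullback f g h (U.map p) → ∃ C' : C, Nonempty (U.obj C' ≅ A) := by
  refine ((adjSquare (Over.mapPullbackAdj p) (Over.mapPullbackAdj (U.map p))
    (postIso U p)).main _ _ (Over.post U)
    (adjSquareIso (Over.mapPullbackAdj p) (Over.mapPullbackAdj (U.map p))
      (postIso U p)) hUp).trans ?_
  constructor
  · intro H P A f g h hpb
    obtain ⟨g', rfl⟩ := U.map_surjective g
    obtain ⟨Y, ⟨e⟩⟩ := H (Over.mk h) (Over.mk g')
      ⟨Over.isoMk hpb.isoPullback hpb.isoPullback_hom_snd⟩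
    exact ⟨Y.left, ⟨(Over.forget _).mapIso e⟩⟩
  · rintro H A X ⟨e⟩
    let e₁ : U.obj X.left ≅ pullback A.hom (U.map p) := (Over.forget _).mapIso e
    have he : e₁.hom ≫ pullback.snd A.hom (U.map p) = U.map X.hom := Over.w e.hom
    have hpb : IsPullback (e₁.hom ≫ pullback.fst A.hom (U.map p)) (U.map X.hom) A.hom
        (U.map p) :=
      IsPullback.of_iso (IsPullback.of_hasPullback A.hom (U.map p)) e₁.symm (Iso.refl _)
        (Iso.refl _) (Iso.refl _) (by simp) (by simp [← he]) (by simp) (by simp)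
    obtain ⟨Y, ⟨y⟩⟩ := H _ _ _ _ _ hpb
    obtain ⟨k, hk⟩ := U.map_surjective (y.hom ≫ A.hom)
    exact ⟨Over.mk k, ⟨Over.isoMk y hk.symm⟩⟩
end
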